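/- Let G be an (n,d,λ)-graph with 0 < λ ≤ d/2, let S be a set of at least k ≥ 1 vertices, let t be any vertex, let m be a positive integer with m ≥ lg_{d/λ} n, and let τ be a positive integer. If τ independent uniformly random walks of length 3m are started at t, then the probability that none of them visits S is at most exp(−τ·m·k/(2n) + τ/n). In particular, for 0 < δ < 1, if k = ⌈√(7·n·ln(1/δ))⌉ ≤ n and τ = ⌈k/(3m)⌉, then for n at least a sufficiently large absolute constant this probability is at most δ; hence a BFS tree from s containing k vertices together with these τ random walks from t finds an s-t path of length O(lg_{d/λ} n) with probability at least 1−δ. -/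

import Mathlib

/-- `G` is an `(n,d,λ)`-graph: a simple `d`-regular graph on `n` vertices whose adjacency
matrix has all eigenvalues corresponding to eigenvectors orthogonal to the all-ones vector
bounded by `lam` in absolute value. -/
def IsNDLGraph (n d : ℕ) (lam : ℝ) (G : SimpleGraph (Fin n)) [DecidableRel G.Adj] : Prop :=
  G.IsRegularOfDegree d ∧
    ∀ (μ : ℝ) (v : Fin n → ℝ), v ≠ 0 → Matrix.mulVec (G.adjMatrix ℝ) v = μ • v →
      (∑ i, v i) = 0 → |μ| ≤ lam

/-- `w : Fin (L+1) → V` is a walk of length `L` in `G`: a sequence of `L+1` vertices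
in which consecutive vertices are adjacent. -/
def IsWalkSeq {n : ℕ} (G : SimpleGraph (Fin n)) (L : ℕ) (w : Fin (L + 1) → Fin n) : Prop :=
  ∀ i : Fin L, G.Adj (w i.castSucc) (w i.succ)

open Matrix in
lemma aux_spec {n d : ℕ} {lam : ℝ} {G : SimpleGraph (Fin n)} [DecidableRel G.Adj]
    (h : IsNDLGraph n d lam G) (hl : 0 < lam) (hn : 0 < n) (v : Fin n → ℝ) (hv : ∑ i, v i = 0) :
    ∑ i, (G.adjMatrix ℝ *ᵥ v) i ^ 2 ≤ lam ^ 2 * ∑ i, v i ^ 2 := by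
  classical
  obtain ⟨hreg, hspec⟩ := h
  have hn' : (n : ℝ) ≠ 0 := by positivity
  set A := G.adjMatrix ℝ with hA
  have hrow : ∀ j, ∑ i, A i j = d := by
    intro j
    have h1 : ∑ i, A i j = ∑ i, A j i := by
      refine Finset.sum_congr rfl fun i _ => ?_
      simp [hA, SimpleGraph.adjMatrix_apply, G.adj_comm]
    rw [h1]
    have := hreg j
    simp [hA, SimpleGraph.adjMatrix_apply, Finset.sum_boole, ← this, SimpleGraph.degree,
      SimpleGraph.neighborFinset_eq_filter]
  have hsumA : ∀ w : Fin n → ℝ, ∑ i, (A *ᵥ w) i = d * ∑ i, w i := by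
    intro w
    simp only [Matrix.mulVec, dotProduct]
    rw [Finset.sum_comm, Finset.mul_sum]
    refine Finset.sum_congr rfl fun j _ => ?_
    rw [← Finset.sum_mul, hrow]
  set B : Matrix (Fin n) (Fin n) ℝ := A - Matrix.of (fun _ _ => (d : ℝ) / n) with hB
  have hBv : ∀ w i, (B *ᵥ w) i = (A *ᵥ w) i - d / n * ∑ j, w j := by
    intro w i
    rw [hB, Matrix.sub_mulVec]
    simp [Matrix.mulVec, dotProduct, Finset.mul_sum]
  have hBsum : ∀ w : Fin n → ℝ, ∑ i, (B *ᵥ w) i = 0 := by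
    intro w
    simp only [hBv, Finset.sum_sub_distrib, hsumA]
    simp
    field_simp
    ring
  have hBh : B.IsHermitian := by
    ext i j
    simp [hB, hA, SimpleGraph.adjMatrix_apply, G.adj_comm]
  have hev : ∀ i, |hBh.eigenvalues i| ≤ lam := by
    intro i
    by_cases h0 : hBh.eigenvalues i = 0
    · rw [h0]; simpa using hl.le
    have e1 := hBh.mulVec_eigenvectorBasis i
    set w : Fin n → ℝ := ⇑(hBh.eigenvectorBasis i) with hw
    have hs : ∑ j, w j = 0 := by
      have e2 := hBsum w
      rw [e1] at e2
      simp only [Pi.smul_apply, smul_eq_mul, ← Finset.mul_sum] at e2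
      exact (mul_eq_zero.mp e2).resolve_left h0
    refine hspec _ w ?_ ?_ hs
    · intro hw0
      have := hBh.eigenvectorBasis.orthonormal.ne_zero i
      apply this
      ext j
      exact congrFun hw0 j
    · rw [← e1]
      ext j
      rw [hBv, hs]; simp [hA]
  have hAB : A *ᵥ v = B *ᵥ v := by
    ext i; rw [hBv, hv]; simp
  rw [hAB]
  let b := hBh.eigenvectorBasis
  have hnorm : ∀ x : Fin n → ℝ, ∑ i, x i ^ 2 = ∑ i, (x ⬝ᵥ ⇑(b i)) ^ 2 := by
    intro x
    have e1 := b.sum_sq_norm_inner_right (WithLp.toLp 2 x)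
    rw [EuclideanSpace.norm_sq_eq] at e1
    simp only [Real.norm_eq_abs, sq_abs] at e1
    rw [← e1]
    refine Finset.sum_congr rfl fun i _ => ?_
    simp [PiLp.inner_apply, dotProduct]
  rw [hnorm, hnorm v, Finset.mul_sum]
  refine Finset.sum_le_sum fun i _ => ?_
  have : (B *ᵥ v) ⬝ᵥ ⇑(b i) = hBh.eigenvalues i * (v ⬝ᵥ ⇑(b i)) := by
    have hT : Bᵀ = B := by simpa using hBh.eq
    rw [dotProduct_comm, dotProduct_mulVec, ← mulVec_transpose, hT,
      hBh.mulVec_eigenvectorBasis i, smul_dotProduct, dotProduct_comm]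
    rfl
  rw [this, mul_pow]
  refine mul_le_mul_of_nonneg_right ?_ (sq_nonneg _)
  rw [← sq_abs]
  exact pow_le_pow_left₀ (abs_nonneg _) (hev i) 2

open Matrix in
lemma aux_sum {n d : ℕ} {G : SimpleGraph (Fin n)} [DecidableRel G.Adj]
    (hreg : G.IsRegularOfDegree d) (w : Fin n → ℝ) :
    ∑ i, (G.adjMatrix ℝ *ᵥ w) i = d * ∑ i, w i := by
  have hrow : ∀ j, ∑ i, G.adjMatrix ℝ i j = d := by
    intro j
    have h1 : ∑ i, G.adjMatrix ℝ i j = ∑ i, G.adjMatrix ℝ j i := by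
      refine Finset.sum_congr rfl fun i _ => ?_
      simp [SimpleGraph.adjMatrix_apply, G.adj_comm]
    rw [h1]
    have := hreg j
    simp [SimpleGraph.adjMatrix_apply, Finset.sum_boole, ← this, SimpleGraph.degree,
      SimpleGraph.neighborFinset_eq_filter]
  simp only [Matrix.mulVec, dotProduct]
  rw [Finset.sum_comm, Finset.mul_sum]
  refine Finset.sum_congr rfl fun j _ => ?_
  rw [← Finset.sum_mul, hrow]

open Matrix in
lemma aux_const {n d : ℕ} {G : SimpleGraph (Fin n)} [DecidableRel G.Adj]
    (hreg : G.IsRegularOfDegree d) (a : ℝ) :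
    G.adjMatrix ℝ *ᵥ (fun _ => a) = fun _ => d * a := by
  ext j
  have := hreg j
  simp only [Matrix.mulVec, dotProduct, ← Finset.sum_mul]
  congr 1
  simp [SimpleGraph.adjMatrix_apply, ← this, SimpleGraph.degree,
      SimpleGraph.neighborFinset_eq_filter]

/-- decomposition -/
lemma aux_decomp {n : ℕ} (hn : 0 < n) (x : Fin n → ℝ) :
    ∃ (a : ℝ) (y : Fin n → ℝ), x = (fun _ => a) + y ∧ ∑ i, y i = 0 ∧ n * a = ∑ i, x i ∧
      ∑ i, x i ^ 2 = n * a ^ 2 + ∑ i, y i ^ 2 := by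
  have hn' : (n : ℝ) ≠ 0 := by positivity
  have h0 : ∑ i, (x i - (∑ i, x i) / n) = 0 := by
    simp [Finset.sum_sub_distrib]; field_simp; ring
  refine ⟨(∑ i, x i) / n, fun i => x i - (∑ i, x i) / n, ?_, h0, by field_simp, ?_⟩
  · ext i; simp
  · generalize (∑ i, x i) / n = a at *
    have : ∀ i, x i ^ 2 = a ^ 2 + (x i - a) ^ 2 + 2 * a * (x i - a) := fun i => by ring
    rw [Finset.sum_congr rfl fun i _ => this i, Finset.sum_add_distrib, Finset.sum_add_distrib,
      ← Finset.mul_sum, h0]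
    simp

open Matrix in
lemma aux_mix {n d : ℕ} {lam : ℝ} {G : SimpleGraph (Fin n)} [DecidableRel G.Adj]
    (h : IsNDLGraph n d lam G) (hl : 0 < lam) (hn : 0 < n) (g : ℕ → Fin n → ℝ)
    (hg0 : ∀ j i, 0 ≤ g j i) (L : ℕ)
    (hg : ∀ j i, g (j + 1) i ≤ (G.adjMatrix ℝ *ᵥ g j) i) (m : ℕ)
    (hm : lam ^ m * n ≤ (d : ℝ) ^ m) (t : Fin n) :
    g (L + m) t ^ 2 ≤ ((d : ℝ) ^ m) ^ 2 * (1 / n + 1 / n ^ 2) * ∑ i, g L i ^ 2 := by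
  have hn' : (0 : ℝ) < n := by positivity
  obtain ⟨a, y, hx, hy, hna, hq⟩ := aux_decomp hn (g L)
  have key : ∀ j, ∃ z : Fin n → ℝ, (∀ i, g (L + j) i ≤ d ^ j * a + z i) ∧ ∑ i, z i = 0 ∧
      ∑ i, z i ^ 2 ≤ (lam ^ j) ^ 2 * ∑ i, y i ^ 2 := by
    intro j
    induction j with
    | zero => exact ⟨y, fun i => by simp [hx], hy, by simp⟩
    | succ j ih =>
      obtain ⟨z, h1, h2, h3⟩ := ih
      refine ⟨G.adjMatrix ℝ *ᵥ z, fun i => ?_, ?_, ?_⟩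
      · refine (hg (L + j) i).trans ?_
        have e : (d : ℝ) ^ (j + 1) * a + (G.adjMatrix ℝ *ᵥ z) i =
            (G.adjMatrix ℝ *ᵥ ((fun _ => (d : ℝ) ^ j * a) + z)) i := by
          rw [Matrix.mulVec_add, aux_const h.1]; simp only [Pi.add_apply]; ring
        rw [e]
        simp only [Matrix.mulVec, dotProduct]
        refine Finset.sum_le_sum fun u _ => mul_le_mul_of_nonneg_left (h1 u) ?_
        rw [SimpleGraph.adjMatrix_apply]; split_ifs <;> norm_num
      · rw [aux_sum h.1, h2, mul_zero]
      · refine (aux_spec h hl hn z h2).trans ?_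
        refine (mul_le_mul_of_nonneg_left h3 (sq_nonneg _)).trans (le_of_eq ?_)
        ring
  obtain ⟨z, h1, -, h3⟩ := key m
  have hY : 0 ≤ ∑ i, y i ^ 2 := Finset.sum_nonneg fun i _ => sq_nonneg _
  have hz : z t ^ 2 ≤ (lam ^ m) ^ 2 * ∑ i, y i ^ 2 :=
    (Finset.single_le_sum (f := fun i => z i ^ 2) (fun i _ => sq_nonneg _)
      (Finset.mem_univ t)).trans h3
  have hlm : lam ^ m ≤ (d : ℝ) ^ m / n := by rw [le_div_iff₀ hn']; exact hm
  have hz2 : z t ^ 2 ≤ ((d : ℝ) ^ m / n) ^ 2 * ∑ i, y i ^ 2 :=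
    hz.trans (mul_le_mul_of_nonneg_right (pow_le_pow_left₀ (by positivity) hlm 2) hY)
  have h4 : g (L + m) t ^ 2 ≤ ((d : ℝ) ^ m * a + z t) ^ 2 :=
    pow_le_pow_left₀ (hg0 _ _) (h1 t) 2
  refine h4.trans ?_
  rw [hq]
  set Y := ∑ i, y i ^ 2
  set D := (d : ℝ) ^ m
  have hz3 : z t ^ 2 * n ^ 2 ≤ D ^ 2 * Y := by
    have : (D / n) ^ 2 * Y = D ^ 2 * Y / n ^ 2 := by ring
    rw [this, le_div_iff₀ (by positivity)] at hz2
    exact hz2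
  have e : D ^ 2 * (1 / n + 1 / n ^ 2) * (n * a ^ 2 + Y) =
     (D ^ 2 * n ^ 2 * a ^ 2 + D ^ 2 * n * a ^ 2 + n * (D ^ 2 * Y) + D ^ 2 * Y) / n ^ 2 := by
    field_simp; ring
  rw [e, le_div_iff₀ (by positivity)]
  have hsq : 0 ≤ n * (D * a - n * z t) ^ 2 := by positivity
  have := mul_le_mul_of_nonneg_left hz3 hn'.le
  nlinarith

/-- bilinear bound -/
lemma aux_real (N a b X Y U V d lam β p : ℝ) (hN : 0 < N) (_ : 0 ≤ X) (_ : 0 ≤ Y)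
    (hU : U ^ 2 = N * a ^ 2 + X ^ 2) (hV : V ^ 2 = N * b ^ 2 + Y ^ 2) (hU0 : 0 ≤ U) (hV0 : 0 ≤ V)
    (ha : N * a ^ 2 ≤ β * U ^ 2) (hb : N * b ^ 2 ≤ β * V ^ 2) (hβ : 0 ≤ β)
    (hl : 0 ≤ lam) (hd : lam ≤ d) (hp : p ≤ d * (N * a * b) + lam * (X * Y)) :
    p ≤ ((d - lam) * β + lam) * (U * V) := by
  have h1 : N * a * b ≤ β * (U * V) := by
    refine abs_le_of_sq_le_sq' ?_ (by positivity) |>.2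
    have := mul_le_mul ha hb (by positivity) (by positivity)
    calc (N * a * b) ^ 2 = N * a ^ 2 * (N * b ^ 2) := by ring
      _ ≤ _ := this
      _ = _ := by ring
  have h2 : N * a * b + X * Y ≤ U * V := by
    refine abs_le_of_sq_le_sq' ?_ (by positivity) |>.2
    rw [mul_pow, hU, hV]
    have : 0 ≤ N * (a * Y - b * X) ^ 2 := by positivity
    nlinarith
  nlinarith [mul_le_mul_of_nonneg_left h1 (sub_nonneg.2 hd), mul_le_mul_of_nonneg_left h2 hl]

open Matrix in
lemma aux_hit {n d : ℕ} {lam : ℝ} {G : SimpleGraph (Fin n)} [DecidableRel G.Adj]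
    (h : IsNDLGraph n d lam G) (hl : 0 < lam) (hld : lam ≤ d / 2) (hn : 0 < n)
    (S : Finset (Fin n)) (k : ℕ) (hk : k ≤ S.card)
    (g f : Fin n → ℝ) (hgS : ∀ i ∈ S, g i = 0)
    (hf : ∀ i, f i = if i ∈ S then 0 else (G.adjMatrix ℝ *ᵥ g) i) :
    ∑ i, f i ^ 2 ≤ (d * (1 - k / (2 * n))) ^ 2 * ∑ i, g i ^ 2 := by
  have hn' : (0 : ℝ) < n := by positivity
  have hfS : ∀ i ∈ S, f i = 0 := fun i hi => by rw [hf]; simp [hi]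
  have hkn : k ≤ n := hk.trans (by simpa using Finset.card_le_univ S)
  have hkn' : (k : ℝ) / n ≤ 1 := by
    rw [div_le_one hn']; exact_mod_cast hkn
  have hβ : (0 : ℝ) ≤ 1 - k / n := by linarith
  have cs : ∀ (x : Fin n → ℝ) (a : ℝ), (∀ i ∈ S, x i = 0) → n * a = ∑ i, x i →
      n * a ^ 2 ≤ (1 - k / n) * ∑ i, x i ^ 2 := by
    intro x a hx ha
    have e1 : ∑ i, x i = ∑ i ∈ Sᶜ, x i := by
      symm
      apply Finset.sum_subset (Finset.subset_univ _)
      intro i _ hi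
      exact hx i (by simpa using hi)
    have e2 : ∑ i ∈ Sᶜ, x i ^ 2 ≤ ∑ i, x i ^ 2 :=
      Finset.sum_le_sum_of_subset_of_nonneg (Finset.subset_univ _) fun _ _ _ => sq_nonneg _
    have e3 := sq_sum_le_card_mul_sum_sq (s := Sᶜ) (f := x)
    have e4 : ((Sᶜ).card : ℝ) ≤ n - k := by
      rw [Finset.card_compl, Fintype.card_fin, Nat.cast_sub (by simpa using Finset.card_le_univ S)]
      have : (k : ℝ) ≤ S.card := by exact_mod_cast hk
      linarith
    rw [← e1, ← ha] at e3
    have e5 : (n * a) ^ 2 ≤ (n - k) * ∑ i, x i ^ 2 :=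
      e3.trans (mul_le_mul e4 e2 (Finset.sum_nonneg fun _ _ => sq_nonneg _)
        (by have : (k : ℝ) ≤ n := by exact_mod_cast hkn
            linarith))
    have e6 : (1 - (k : ℝ) / n) * ∑ i, x i ^ 2 = ((n - k) * ∑ i, x i ^ 2) / n := by
      field_simp
    rw [e6, le_div_iff₀ hn']
    linarith
  obtain ⟨a, x, hx, hxs, hna, hxq⟩ := aux_decomp hn f
  obtain ⟨b, y, hy, hys, hnb, hyq⟩ := aux_decomp hn g
  have c1 := cs f a hfS hna
  have c2 := cs g b hgS hnb
  have Qf : 0 ≤ ∑ i, f i ^ 2 := Finset.sum_nonneg fun _ _ => sq_nonneg _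
  have Qg : 0 ≤ ∑ i, g i ^ 2 := Finset.sum_nonneg fun _ _ => sq_nonneg _
  have Qx : 0 ≤ ∑ i, x i ^ 2 := Finset.sum_nonneg fun _ _ => sq_nonneg _
  have Qy : 0 ≤ ∑ i, y i ^ 2 := Finset.sum_nonneg fun _ _ => sq_nonneg _
  have hsp := aux_spec h hl hn y hys
  have hAs : ∑ i, (G.adjMatrix ℝ *ᵥ y) i = 0 := by rw [aux_sum h.1, hys, mul_zero]
  have hp : ∑ i, f i ^ 2 ≤ d * (n * a * b) +
      lam * (√(∑ i, x i ^ 2) * √(∑ i, y i ^ 2)) := by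
    have e1 : ∑ i, f i ^ 2 = ∑ i, f i * (G.adjMatrix ℝ *ᵥ g) i := by
      refine Finset.sum_congr rfl fun i _ => ?_
      by_cases hi : i ∈ S
      · simp [hfS i hi]
      · have := hf i
        rw [if_neg hi] at this
        rw [← this]; ring
    have e2 : ∀ i, f i * (G.adjMatrix ℝ *ᵥ g) i =
        f i * (d * b) + a * (G.adjMatrix ℝ *ᵥ y) i + x i * (G.adjMatrix ℝ *ᵥ y) i := by
      intro i
      have e3 : (G.adjMatrix ℝ *ᵥ g) i = d * b + (G.adjMatrix ℝ *ᵥ y) i := by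
        rw [hy, Matrix.mulVec_add, aux_const h.1]; rfl
      have e4 : f i = a + x i := congrFun hx i
      rw [e3, e4]; ring
    rw [e1, Finset.sum_congr rfl fun i _ => e2 i, Finset.sum_add_distrib, Finset.sum_add_distrib,
      ← Finset.mul_sum, hAs, ← Finset.sum_mul, ← hna]
    have e5 := Real.sum_mul_le_sqrt_mul_sqrt Finset.univ x (G.adjMatrix ℝ *ᵥ y)
    have e6 : √(∑ i, (G.adjMatrix ℝ *ᵥ y) i ^ 2) ≤ lam * √(∑ i, y i ^ 2) := by
      refine (Real.sqrt_le_sqrt hsp).trans (le_of_eq ?_)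
      rw [Real.sqrt_mul (sq_nonneg _), Real.sqrt_sq hl.le]
    have e7 := mul_le_mul_of_nonneg_left e6 (Real.sqrt_nonneg (∑ i, x i ^ 2))
    linarith
  have hd : lam ≤ d := by linarith
  have fin := aux_real n a b _ _ (√(∑ i, f i ^ 2)) (√(∑ i, g i ^ 2)) d lam (1 - k / n) _ hn'
    (Real.sqrt_nonneg _) (Real.sqrt_nonneg _)
    (by rw [Real.sq_sqrt Qf, Real.sq_sqrt Qx, hxq]) (by rw [Real.sq_sqrt Qg, Real.sq_sqrt Qy, hyq])
    (Real.sqrt_nonneg _) (Real.sqrt_nonneg _) (by rw [Real.sq_sqrt Qf]; exact c1)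
    (by rw [Real.sq_sqrt Qg]; exact c2) hβ hl.le hd hp
  have hc : ((d : ℝ) - lam) * (1 - k / n) + lam ≤ d * (1 - k / (2 * n)) := by
    have e : (k : ℝ) / (2 * n) = k / n / 2 := by ring
    have : (0 : ℝ) ≤ k / n := by positivity
    rw [e]; nlinarith
  have hc0 : (0 : ℝ) ≤ d * (1 - k / (2 * n)) :=
    le_trans (by have := mul_nonneg (sub_nonneg.2 hd) hβ; linarith) hc
  set c := (d : ℝ) * (1 - k / (2 * n))
  have hU := Real.sqrt_nonneg (∑ i, f i ^ 2)
  have hV := Real.sqrt_nonneg (∑ i, g i ^ 2)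
  have Uf := Real.sq_sqrt Qf
  have Vg := Real.sq_sqrt Qg
  set U := √(∑ i, f i ^ 2)
  set V := √(∑ i, g i ^ 2)
  have fin2 : U ^ 2 ≤ c * (U * V) := Uf.le.trans <| fin.trans (mul_le_mul_of_nonneg_right hc (by positivity))
  have : U ≤ c * V := by
    rcases hU.eq_or_lt with h0 | h0
    · rw [← h0]; positivity
    · nlinarith
  rw [← Uf, ← Vg, ← mul_pow]
  exact pow_le_pow_left₀ hU this 2

open Matrix in
/-- walk counting vector -/
noncomputable def gvec {n : ℕ} (G : SimpleGraph (Fin n)) [DecidableRel G.Adj]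
    (S : Finset (Fin n)) : ℕ → Fin n → ℝ
  | 0 => fun i => if i ∈ S then 0 else 1
  | (j + 1) => fun i => if i ∈ S then 0 else (G.adjMatrix ℝ *ᵥ gvec G S j) i

lemma card_le_gvec {n : ℕ} (G : SimpleGraph (Fin n)) [DecidableRel G.Adj]
    (S : Finset (Fin n)) (L : ℕ) (t : Fin n) :
    (Nat.card {w : Fin (L + 1) → Fin n // (IsWalkSeq G L w ∧ w 0 = t) ∧ ∀ i, w i ∉ S} : ℝ)
      ≤ gvec G S L t := by
  classical
  induction L generalizing t with
  | zero =>
    by_cases ht : t ∈ S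
    · have : IsEmpty {w : Fin (0 + 1) → Fin n // (IsWalkSeq G 0 w ∧ w 0 = t) ∧ ∀ i, w i ∉ S} :=
        ⟨fun w => w.2.2 0 (by rw [w.2.1.2]; exact ht)⟩
      rw [Nat.card_of_isEmpty]
      simp [gvec, ht]
    · have : Subsingleton {w : Fin (0 + 1) → Fin n // (IsWalkSeq G 0 w ∧ w 0 = t) ∧ ∀ i, w i ∉ S} :=
        ⟨fun w w' => by
          ext i
          have hi : i = 0 := by apply Fin.ext; have := i.2; simp at this ⊢
          rw [hi, w.2.1.2, w'.2.1.2]⟩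
      simp only [gvec, ht, if_false]
      exact_mod_cast Finite.card_le_one_iff_subsingleton.2 this
  | succ L ih =>
    by_cases ht : t ∈ S
    · have : IsEmpty {w : Fin (L + 1 + 1) → Fin n // (IsWalkSeq G (L + 1) w ∧ w 0 = t) ∧ ∀ i, w i ∉ S} :=
        ⟨fun w => w.2.2 0 (by rw [w.2.1.2]; exact ht)⟩
      rw [Nat.card_of_isEmpty]
      simp [gvec, ht]
    · let T := Σ u : {u // G.Adj t u},
        {w : Fin (L + 1) → Fin n // (IsWalkSeq G L w ∧ w 0 = u.1) ∧ ∀ i, w i ∉ S}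
      let F : {w : Fin (L + 1 + 1) → Fin n // (IsWalkSeq G (L + 1) w ∧ w 0 = t) ∧ ∀ i, w i ∉ S} → T :=
        fun w => ⟨⟨w.1 1, by
            have := w.2.1.1 0
            have h0 := w.2.1.2; simpa [h0] using this⟩,
          ⟨fun i => w.1 i.succ, ⟨⟨fun i => by
            have := w.2.1.1 i.succ
            simpa using this, by simp⟩, fun i => w.2.2 _⟩⟩⟩
      have hF : Function.Injective F := by
        intro w w' hww
        have h1 : ∀ i : Fin (L + 1), w.1 i.succ = w'.1 i.succ := by
          have : ∀ p q : T, p = q → ∀ i, p.2.1 i = q.2.1 i := by rintro p _ rfl i; rfl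
          exact this _ _ hww
        apply Subtype.ext
        funext i
        refine Fin.cases ?_ h1 i
        rw [w.2.1.2, w'.2.1.2]
      have hc := Nat.card_le_card_of_injective F hF
      have hT : (Nat.card T : ℝ) ≤ gvec G S (L + 1) t := by
        rw [Nat.card_sigma, Nat.cast_sum]
        simp only [gvec, ht, if_false, Matrix.mulVec, dotProduct, SimpleGraph.adjMatrix_apply,
          ite_mul, one_mul, zero_mul]
        rw [← Finset.sum_filter, Finset.sum_subtype (p := fun u => G.Adj t u) _ (by simp)]
        exact Finset.sum_le_sum fun u _ => ih u.1
      exact le_trans (by exact_mod_cast hc) hT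

lemma gvec_nonneg {n : ℕ} (G : SimpleGraph (Fin n)) [DecidableRel G.Adj]
    (S : Finset (Fin n)) (L : ℕ) (t : Fin n) : 0 ≤ gvec G S L t :=
  (Nat.cast_nonneg _).trans (card_le_gvec G S L t)

open Matrix in
lemma aux_Anonneg {n : ℕ} (G : SimpleGraph (Fin n)) [DecidableRel G.Adj]
    (x : Fin n → ℝ) (hx : ∀ i, 0 ≤ x i) (i : Fin n) : 0 ≤ (G.adjMatrix ℝ *ᵥ x) i := by
  simp only [Matrix.mulVec, dotProduct]
  refine Finset.sum_nonneg fun u _ => mul_nonneg ?_ (hx u)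
  rw [SimpleGraph.adjMatrix_apply]; split_ifs <;> norm_num

lemma aux_single {n d : ℕ} {lam : ℝ} {G : SimpleGraph (Fin n)} [DecidableRel G.Adj]
    (h : IsNDLGraph n d lam G) (hl : 0 < lam) (hld : lam ≤ d / 2)
    (S : Finset (Fin n)) (k : ℕ) (hk1 : 1 ≤ k) (hk : k ≤ S.card) (t : Fin n) (m : ℕ) (hm : 0 < m)
    (hlog : Real.log n / Real.log (d / lam) ≤ (m : ℝ)) :
    gvec G S (3 * m) t ≤ (d : ℝ) ^ (3 * m) * Real.exp (-((m : ℝ) * k) / (2 * n)) := by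
  have hn : 0 < n := t.pos
  have hn' : (0 : ℝ) < n := by positivity
  have hd : (0 : ℝ) < d := by linarith
  have hkn : (k : ℝ) ≤ n := by exact_mod_cast hk.trans (by simpa using Finset.card_le_univ S)
  have hlm : lam ^ m * n ≤ (d : ℝ) ^ m := by
    have h2 : 1 < d / lam := by rw [lt_div_iff₀ hl]; linarith
    have h3 := Real.log_pos h2
    rw [div_le_iff₀ h3, ← Real.log_pow] at hlog
    have h4 := (Real.log_le_log_iff hn' (by positivity)).1 hlog
    rw [div_pow, le_div_iff₀ (by positivity)] at h4
    linarith
  have hgS : ∀ j, ∀ i ∈ S, gvec G S j i = 0 := by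
    intro j i hi
    cases j <;> simp [gvec, hi]
  have hQ : ∀ j, ∑ i, gvec G S j i ^ 2 ≤ ((d * (1 - k / (2 * n)) : ℝ) ^ j) ^ 2 * n := by
    intro j
    induction j with
    | zero =>
      have : ∀ i, gvec G S 0 i ^ 2 ≤ 1 := by
        intro i; simp only [gvec]; split_ifs <;> norm_num
      refine (Finset.sum_le_sum fun i _ => this i).trans ?_
      simp
    | succ j ih =>
      refine (aux_hit h hl hld hn S k hk (gvec G S j) (gvec G S (j + 1)) (hgS j)
        (fun i => rfl)).trans ?_
      refine (mul_le_mul_of_nonneg_left ih (sq_nonneg _)).trans (le_of_eq ?_)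
      ring
  have hmix := aux_mix h hl hn (gvec G S) (gvec_nonneg G S) (2 * m) (fun j i => by
    simp only [gvec]
    split_ifs
    · exact aux_Anonneg G _ (gvec_nonneg G S j) i
    · exact le_rfl) m hlm t
  have e3 : 2 * m + m = 3 * m := by ring
  rw [e3] at hmix
  have hpos : (0 : ℝ) ≤ ((d : ℝ) ^ m) ^ 2 * (1 / n + 1 / n ^ 2) := by positivity
  have h5 := hmix.trans (mul_le_mul_of_nonneg_left (hQ (2 * m)) hpos)
  refine abs_le_of_sq_le_sq' ?_ (by positivity) |>.2
  refine h5.trans ?_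
  have hq0 : (0 : ℝ) ≤ 1 - k / (2 * n) := by
    have : (k : ℝ) / (2 * n) ≤ 1 := by rw [div_le_one (by positivity)]; linarith
    linarith
  have hq : ((1 - k / (2 * n) : ℝ)) ^ (4 * m) ≤ Real.exp (-(2 * m * k) / n) := by
    have := Real.add_one_le_exp (-(k / (2 * n) : ℝ))
    refine (pow_le_pow_left₀ hq0 (by linarith) (4 * m)).trans (le_of_eq ?_)
    rw [← Real.exp_nat_mul]
    congr 1
    push_cast; field_simp; ring
  have h1n : (1 + 1 / n : ℝ) ≤ Real.exp (1 / n) := by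
    have := Real.add_one_le_exp (1 / n : ℝ); linarith
  have hmk : (1 : ℝ) ≤ m * k := by exact_mod_cast Nat.mul_pos hm hk1
  have hfin : (1 + 1 / n : ℝ) * (1 - k / (2 * n) : ℝ) ^ (4 * m) ≤
      Real.exp (-((m : ℝ) * k) / (2 * n)) ^ 2 := by
    refine (mul_le_mul h1n hq (by positivity) (Real.exp_nonneg _)).trans ?_
    rw [← Real.exp_add, ← Real.exp_nat_mul]
    apply Real.exp_le_exp.2
    have e : ((2 : ℕ) : ℝ) * (-((m : ℝ) * k) / (2 * n)) - (1 / n + -(2 * m * k) / n) =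
      (m * k - 1) / n := by push_cast; field_simp; ring
    have : 0 ≤ (m * k - 1 : ℝ) / n := div_nonneg (by linarith) hn'.le
    linarith
  calc _ = ((d : ℝ) ^ (3 * m)) ^ 2 * ((1 + 1 / n : ℝ) * (1 - k / (2 * n) : ℝ) ^ (4 * m)) := by
        have e1 : ((1 - k / (2 * n) : ℝ)) ^ (4 * m) = ((1 - k / (2 * n) : ℝ) ^ (2 * m)) ^ 2 := by
          rw [← pow_mul]; congr 1; ring
        have e2 : (d : ℝ) ^ (3 * m) = d ^ m * d ^ (2 * m) := by rw [← pow_add]; congr 1; ring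
        rw [e1, e2, mul_pow _ _ (2 * m)]
        field_simp
    _ ≤ ((d : ℝ) ^ (3 * m)) ^ 2 * Real.exp (-((m : ℝ) * k) / (2 * n)) ^ 2 :=
        mul_le_mul_of_nonneg_left hfin (sq_nonneg _)
    _ = _ := by ring

lemma aux_tuple {n d : ℕ} {lam : ℝ} {G : SimpleGraph (Fin n)} [DecidableRel G.Adj]
    (h : IsNDLGraph n d lam G) (hl : 0 < lam) (hld : lam ≤ d / 2)
    (S : Finset (Fin n)) (k : ℕ) (hk1 : 1 ≤ k) (hk : k ≤ S.card) (t : Fin n) (m : ℕ) (hm : 0 < m)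
    (hlog : Real.log n / Real.log (d / lam) ≤ (m : ℝ)) (τ : ℕ) :
    (Nat.card {F : Fin τ → (Fin (3 * m + 1) → Fin n) //
          ∀ j : Fin τ, (IsWalkSeq G (3 * m) (F j) ∧ F j 0 = t) ∧
            ∀ i : Fin (3 * m + 1), F j i ∉ S} : ℝ)
        ≤ (d : ℝ) ^ (3 * m * τ) * Real.exp (-((τ : ℝ) * m * k) / (2 * n)) := by
  have e := Nat.card_congr (Equiv.subtypePiEquivPi (α := Fin τ)
    (β := fun _ => Fin (3 * m + 1) → Fin n)
    (p := fun _ w => (IsWalkSeq G (3 * m) w ∧ w 0 = t) ∧ ∀ i : Fin (3 * m + 1), w i ∉ S))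
  rw [e, Nat.card_pi, Finset.prod_const, Finset.card_univ, Fintype.card_fin, Nat.cast_pow]
  have h1 := (card_le_gvec G S (3 * m) t).trans
    (aux_single h hl hld S k hk1 hk t m hm hlog)
  refine (pow_le_pow_left₀ (Nat.cast_nonneg _) h1 τ).trans (le_of_eq ?_)
  rw [mul_pow, ← pow_mul, ← Real.exp_nat_mul]
  congr 2
  ring

/-- Let `G` be an `(n,d,λ)`-graph with `0 < λ ≤ d/2`, `S` a set of at least `k ≥ 1`
vertices, `t` a vertex, `m ≥ log_{d/λ} n` a positive integer and `τ` a positive integer.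
If `τ` independent uniformly random walks of length `3m` are started at `t` (so the tuples
of walks are uniform among the `d^{3mτ} = (d^{3m})^τ` possibilities), the probability that
none of them visits `S` is at most `exp(−τ·m·k/(2n) + τ/n)`; stated here by counting: the
number of such tuples avoiding `S` is at most `d^{3mτ}·exp(−τ·m·k/(2n) + τ/n)`.
In particular there is an absolute constant `N₀` such that if `k = ⌈√(7·n·ln(1/δ))⌉ ≤ n`,
`τ = ⌈k/(3m)⌉` and `n ≥ N₀`, this probability is at most `δ` (whence a BFS tree from `s`
with `k` vertices together with these `τ` walks from `t` finds an `s`-`t` path of length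
`O(log_{d/λ} n)` with probability at least `1−δ`). -/
theorem stmt6 : ∃ N₀ : ℕ, ∀ (n d : ℕ) (lam : ℝ) (G : SimpleGraph (Fin n))
    (_ : DecidableRel G.Adj),
    IsNDLGraph n d lam G → 0 < lam → lam ≤ d / 2 →
    ∀ (S : Finset (Fin n)) (k : ℕ), 1 ≤ k → k ≤ S.card →
    ∀ (t : Fin n) (m : ℕ), 0 < m → Real.log n / Real.log (d / lam) ≤ (m : ℝ) →
    ∀ (τ : ℕ), 0 < τ →
    ∀ (δ : ℝ), 0 < δ → δ < 1 →
      ((Nat.card {F : Fin τ → (Fin (3 * m + 1) → Fin n) //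
          ∀ j : Fin τ, (IsWalkSeq G (3 * m) (F j) ∧ F j 0 = t) ∧
            ∀ i : Fin (3 * m + 1), F j i ∉ S} : ℝ)
        ≤ (d : ℝ) ^ (3 * m * τ) * Real.exp (-((τ : ℝ) * m * k) / (2 * n) + (τ : ℝ) / n)) ∧
      (k = ⌈Real.sqrt (7 * n * Real.log (1 / δ))⌉₊ → k ≤ n → τ = ⌈(k : ℝ) / (3 * m)⌉₊ →
        N₀ ≤ n →
        (Nat.card {F : Fin τ → (Fin (3 * m + 1) → Fin n) //
            ∀ j : Fin τ, (IsWalkSeq G (3 * m) (F j) ∧ F j 0 = t) ∧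
              ∀ i : Fin (3 * m + 1), F j i ∉ S} : ℝ)
          ≤ δ * (d : ℝ) ^ (3 * m * τ)) := by
  refine ⟨0, ?_⟩
  intro n d lam G _ h hl hld S k hk1 hk t m hm hlog τ hτ δ hδ hδ1
  have hn' : (0 : ℝ) < n := by exact_mod_cast t.pos
  have hm' : (0 : ℝ) < m := by exact_mod_cast hm
  have key := aux_tuple h hl hld S k hk1 hk t m hm hlog τ
  refine ⟨key.trans ?_, ?_⟩
  · refine mul_le_mul_of_nonneg_left (Real.exp_le_exp.2 ?_) (by positivity)
    have : (0 : ℝ) ≤ (τ : ℝ) / n := by positivity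
    linarith
  · intro hkd _ hτd _
    refine key.trans ?_
    rw [mul_comm]
    refine mul_le_mul_of_nonneg_right ?_ (by positivity)
    rw [← Real.le_log_iff_exp_le hδ]
    have hL : 0 < Real.log (1 / δ) := Real.log_pos (by rw [lt_div_iff₀ hδ]; linarith)
    have hL2 : Real.log (1 / δ) = - Real.log δ := by rw [one_div, Real.log_inv]
    have h1 : √(7 * n * Real.log (1 / δ)) ≤ k := by rw [hkd]; exact Nat.le_ceil _
    have h2 : 7 * n * Real.log (1 / δ) ≤ (k : ℝ) ^ 2 := by
      rw [Real.sqrt_le_left (by positivity)] at h1; exact h1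
    have h3 : (k : ℝ) / (3 * m) ≤ τ := by rw [hτd]; exact Nat.le_ceil _
    rw [div_le_iff₀ (by positivity)] at h3
    have h4 : (k : ℝ) * k ≤ τ * (3 * m) * k := mul_le_mul_of_nonneg_right h3 (by positivity)
    rw [div_le_iff₀ (by positivity)]
    have := mul_pos hn' hL
    have e : Real.log δ = - Real.log (1 / δ) := by linarith
    rw [e]
    nlinarith
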